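/- Let p, q > 0 with 1/p + 1/q > 1, and let f, g : ℝ → ℝ be functions on a compact interval [a,b] (a < b). Suppose f has finite p-variation, i.e. there is a constant V_f ≥ 0 such that for every n and every finite partition a = x₀ ≤ x₁ ≤ … ≤ x_n = b one has ∑_{i=1}^n |f(x_i) − f(x_{i−1})|^p ≤ V_f^p, and g has finite q-variation with constant V_g in the analogous sense. Suppose further that f and g have no common point of discontinuity in [a,b]. Then the Riemann–Stieltjes integral ∫_a^b f dg exists in the Riemann sense: there is a number I such that for every ε > 0 there exists δ > 0 so that for every partition a = x₀ ≤ … ≤ x_n = b of mesh less than δ and every choice of tags ξ_i ∈ [x_{i−1}, x_i], one has |∑_{i=1}^n f(ξ_i)(g(x_i) − g(x_{i−1})) − I| < ε. -/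

import Mathlib

open Finset Set

/-- stepwise monotone implies monotone up to `n`. -/
lemma yrs_step_mono {n : ℕ} {x : ℕ → ℝ} (h : ∀ i < n, x i ≤ x (i + 1)) :
    ∀ i j, i ≤ j → j ≤ n → x i ≤ x j := by
  intro i j hij
  induction j, hij using Nat.le_induction with
  | base => intro _; exact le_rfl
  | succ k hk ih => intro hn; exact (ih (by omega)).trans (h k (by omega))

/-- The variation function. -/
lemma yrs_var (a b p : ℝ) (f : ℝ → ℝ) (V : ℝ)
    (hvar : ∀ (n : ℕ) (x : ℕ → ℝ), x 0 = a → x n = b →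
      (∀ i < n, x i ≤ x (i + 1)) →
      ∑ i ∈ Finset.range n, |f (x (i + 1)) - f (x i)| ^ p ≤ V) :
    ∃ W : ℝ → ℝ, ∀ s t, a ≤ s → s ≤ t → t ≤ b → |f t - f s| ^ p ≤ W t - W s := by
  let S : ℝ → Set ℝ := fun t => {y | ∃ (n : ℕ) (x : ℕ → ℝ), x 0 = a ∧ x n = t ∧
      (∀ i < n, x i ≤ x (i + 1)) ∧ y = ∑ i ∈ Finset.range n, |f (x (i + 1)) - f (x i)| ^ p}
  have happ : ∀ s t y, s ≤ t → y ∈ S s → y + |f t - f s| ^ p ∈ S t := by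
    rintro s t y hst ⟨n, x, h0, hn, hx, rfl⟩
    refine ⟨n + 1, fun i => if i ≤ n then x i else t, by simp [h0], by simp, ?_, ?_⟩
    · intro i hi
      rcases Nat.lt_succ_iff_lt_or_eq.1 hi with h | h
      · simp [h.le, Nat.succ_le_of_lt h, hx i h]
      · subst h; simp [hn, hst]
    · rw [Finset.sum_range_succ]
      congr 1
      · refine Finset.sum_congr rfl fun i hi => ?_
        have hi := Finset.mem_range.1 hi
        simp [hi.le, Nat.succ_le_of_lt hi]
      · simp [hn]
  have hbd : ∀ t, t ≤ b → BddAbove (S t) := by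
    intro t ht
    refine ⟨V, fun y hy => ?_⟩
    obtain ⟨n, x, h0, hn, hx, h⟩ := happ t b y ht hy
    have := hvar n x h0 hn hx
    have h2 : 0 ≤ |f b - f t| ^ p := by positivity
    linarith
  have hne : ∀ t, a ≤ t → (S t).Nonempty := by
    intro t ht
    exact ⟨_, happ a t 0 ht ⟨0, fun _ => a, rfl, rfl, by simp, by simp⟩⟩
  refine ⟨fun t => sSup (S t), fun s t hs hst ht => ?_⟩
  have : sSup (S s) ≤ sSup (S t) - |f t - f s| ^ p := by
    refine csSup_le (hne s hs) fun y hy => ?_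
    have := le_csSup (hbd t ht) (happ s t y hst hy)
    linarith
  linarith

/-- Discrete sewing estimate. -/
lemma yrs_sew (θ : ℝ) (hθ : 1 < θ) : ∃ C : ℝ, 0 ≤ C ∧ ∀ (F G H : ℕ → ℝ) (K : ℝ) (m n : ℕ), 0 ≤ K →
    (∀ u v, m ≤ u → u ≤ v → v ≤ n → H u ≤ H v) →
    (∀ u v w, m ≤ u → u ≤ v → v ≤ w → w ≤ n →
      |F v - F u| * |G w - G v| ≤ K * (H w - H u) ^ θ) →
    ∀ (d i j : ℕ), j - i ≤ d → m ≤ i → i ≤ j → j ≤ n →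
      |∑ k ∈ Finset.Ico i j, F k * (G (k + 1) - G k) - F i * (G j - G i)|
        ≤ C * K * (H j - H i) ^ θ := by
  have hr : (2 : ℝ) ^ (1 - θ) < 1 := Real.rpow_lt_one_of_one_lt_of_neg (by norm_num) (by linarith)
  have hr' : 0 < 1 - (2 : ℝ) ^ (1 - θ) := by linarith
  set C := 2 / (1 - (2 : ℝ) ^ (1 - θ)) with hC
  have hC0 : 0 ≤ C := by positivity
  have hCeq : C = C * (2 : ℝ) ^ (1 - θ) + 2 := by
    rw [hC]; field_simp; ring
  refine ⟨C, hC0, ?_⟩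
  intro F G H K m n hK hH hFG d
  induction d with
  | zero =>
    intro i j hd hm hij hn
    have : i = j := by omega
    subst this
    have : θ ≠ 0 := by linarith
    simp [Real.zero_rpow this]
  | succ d ih =>
    intro i j hd hm hij hn
    rcases hij.eq_or_lt with rfl | hlt
    · exact ih i i (by omega) hm le_rfl hn
    set L := H j - H i with hL
    have hL0 : 0 ≤ L := sub_nonneg.2 (hH i j hm hij hn)
    -- choose k
    have hex : ∃ k, i ≤ k ∧ k < j ∧ H k - H i ≤ L / 2 ∧ H j - H (k + 1) ≤ L / 2 := by
      classical
      let T := (Finset.Ico i j).filter (fun k => H k - H i ≤ L / 2)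
      have hT : T.Nonempty := ⟨i, by simp [T, hlt]; linarith⟩
      have hmem := T.max'_mem hT
      set k := T.max' hT with hk
      simp only [T, Finset.mem_filter, Finset.mem_Ico] at hmem
      refine ⟨k, hmem.1.1, hmem.1.2, hmem.2, ?_⟩
      by_cases hkj : k + 1 = j
      · rw [hkj]; linarith
      by_contra hcon
      push Not at hcon
      have : k + 1 ∈ T := by
        simp only [T, Finset.mem_filter, Finset.mem_Ico]
        refine ⟨⟨by omega, by omega⟩, by linarith⟩
      have := T.le_max' _ this
      omega
    obtain ⟨k, hik, hkj, h1, h2⟩ := hex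
    have e1 := ih i k (by omega) hm hik (by omega)
    have e2 := ih (k + 1) j (by omega) (by omega) (by omega) hn
    have e3 := hFG i k j hm hik hkj.le hn
    have e4 := hFG k (k + 1) j (by omega) (by omega) (by omega) hn
    have hHk := hH i k hm hik (by omega)
    have hHk2 := hH (k + 1) j (by omega) (by omega) hn
    have hHk3 := hH k j (by omega) (by omega) hn
    have e4' : |F (k + 1) - F k| * |G j - G (k + 1)| ≤ K * L ^ θ := by
      refine e4.trans ?_
      gcongr <;> linarith
    have e1' : C * K * (H k - H i) ^ θ ≤ C * K * (L / 2) ^ θ := by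
      gcongr
    have e2' : C * K * (H j - H (k + 1)) ^ θ ≤ C * K * (L / 2) ^ θ := by
      gcongr
    have hhalf : 2 * (L / 2) ^ θ = (2 : ℝ) ^ (1 - θ) * L ^ θ := by
      rw [Real.div_rpow hL0 (by norm_num), Real.rpow_sub (by norm_num), Real.rpow_one]
      field_simp
    have hsum : ∑ l ∈ Finset.Ico i j, F l * (G (l + 1) - G l) =
        ∑ l ∈ Finset.Ico i k, F l * (G (l + 1) - G l) + F k * (G (k + 1) - G k) +
        ∑ l ∈ Finset.Ico (k + 1) j, F l * (G (l + 1) - G l) := by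
      rw [← Finset.sum_Ico_consecutive _ hik hkj.le, Finset.sum_eq_sum_Ico_succ_bot hkj]
      ring
    rw [← abs_mul] at e3 e4'
    rw [hsum]
    have key : C * K * L ^ θ = 2 * (C * K * (L / 2) ^ θ) + 2 * (K * L ^ θ) := by
      have : 2 * (C * K * (L / 2) ^ θ) = C * K * (2 * (L / 2) ^ θ) := by ring
      rw [this, hhalf]
      calc C * K * L ^ θ = (C * (2 : ℝ) ^ (1 - θ) + 2) * K * L ^ θ := by rw [← hCeq]
        _ = _ := by ring
    rw [key]
    have e1'' := e1.trans e1'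
    have e2'' := e2.trans e2'
    rw [abs_le] at *
    constructor <;> nlinarith [e1''.1, e2''.1, e1''.2, e2''.2, e3.1, e3.2, e4'.1, e4'.2, hL0, hK]

/-- Enumeration of a finite set -/
lemma yrs_enum (R : Finset ℝ) (hR : R.Nonempty) : ∃ x : ℕ → ℝ, Monotone x ∧ (∀ i, x i ∈ R) ∧
    ∀ s ∈ R, ∃ i, x i = s := by
  have hN : 0 < R.card := R.card_pos.2 hR
  let e := R.orderEmbOfFin rfl
  refine ⟨fun i => e ⟨min i (R.card - 1), by omega⟩, ?_, ?_, ?_⟩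
  · intro i j hij
    apply e.monotone
    simp only [Fin.mk_le_mk]
    omega
  · intro i; exact R.orderEmbOfFin_mem rfl _
  · intro s hs
    have : s ∈ Set.range e := by rw [Finset.range_orderEmbOfFin]; exact hs
    obtain ⟨i, rfl⟩ := this
    refine ⟨i, ?_⟩
    have hmin : (⟨min (i : ℕ) (R.card - 1), by omega⟩ : Fin R.card) = i := by
      ext
      simp only
      omega
    exact congrArg e hmin

/-- `M` bounds all the Riemann sum errors on `[s,t]`. -/
def YrsBd (f g : ℝ → ℝ) (s t M : ℝ) : Prop :=
  ∀ (x : ℕ → ℝ) (i j : ℕ), Monotone x → i ≤ j → x i = s → x j = t →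
    |∑ k ∈ Finset.Ico i j, f (x k) * (g (x (k + 1)) - g (x k)) - f s * (g t - g s)| ≤ M

lemma yrs_fin (f g : ℝ → ℝ) (R : Finset ℝ) (hR : R.Nonempty) :
    ∃ Φ : ℝ → ℝ, ∀ s ∈ R, ∀ t ∈ R, s ≤ t → ∀ M, YrsBd f g s t M →
      |Φ t - Φ s - f s * (g t - g s)| ≤ M := by
  obtain ⟨x, hx, -, hs⟩ := yrs_enum R hR
  choose! idx hidx using hs
  refine ⟨fun t => ∑ k ∈ Finset.range (idx t), f (x k) * (g (x (k + 1)) - g (x k)), ?_⟩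
  intro s hs t ht hst M hM
  have hle : idx s ≤ idx t := by
    by_contra hcon
    push Not at hcon
    have h1 := hx hcon.le
    rw [hidx s hs, hidx t ht] at h1
    have : s = t := le_antisymm hst h1
    subst this
    exact lt_irrefl _ hcon
  have := hM x (idx s) (idx t) hx hle (hidx s hs) (hidx t ht)
  rwa [Finset.sum_Ico_eq_sub _ hle] at this

lemma yrs_limit (a b : ℝ) (f g : ℝ → ℝ)
    (hbd : ∀ t ∈ Set.Icc a b, ∃ M, YrsBd f g a t M) :
    ∃ Φ : ℝ → ℝ, ∀ s ∈ Set.Icc a b, ∀ t ∈ Set.Icc a b, s ≤ t → ∀ M, YrsBd f g s t M →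
      |Φ t - Φ s - f s * (g t - g s)| ≤ M := by
  classical
  choose! B hB using hbd
  choose Φ hΦ using fun R : Finset ℝ => yrs_fin f g (insert a R) (Finset.insert_nonempty _ _)
  let Ψ : Finset ℝ → ℝ → ℝ := fun R t => Φ R t - Φ R a
  let U : Ultrafilter (Finset ℝ) := Ultrafilter.of Filter.atTop
  have hU : (U : Filter (Finset ℝ)) ≤ Filter.atTop := Ultrafilter.of_le _
  have hmem : ∀ t : ℝ, ∀ᶠ R in (U : Filter (Finset ℝ)), t ∈ R := fun t =>
    hU ((Filter.eventually_ge_atTop ({t} : Finset ℝ)).mono fun R hR => hR (by simp))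
  have hlim : ∀ t ∈ Set.Icc a b, ∃ y, Filter.Tendsto (fun R => Ψ R t) U (nhds y) := by
    intro t ht
    have hc : IsCompact (Metric.closedBall (f a * (g t - g a)) (B t)) :=
      isCompact_closedBall _ _
    have hev : ∀ᶠ R in (U : Filter (Finset ℝ)),
        Ψ R t ∈ Metric.closedBall (f a * (g t - g a)) (B t) := by
      filter_upwards [hmem t] with R hR
      rw [Metric.mem_closedBall, Real.dist_eq]
      exact hΦ R a (by simp) t (by simp [hR]) ht.1 _ (hB t ht)
    obtain ⟨y, -, hy⟩ := hc.ultrafilter_le_nhds' (U.map fun R => Ψ R t) hev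
    exact ⟨y, hy⟩
  choose! Y hY using hlim
  refine ⟨Y, fun s hs t ht hst M hM => ?_⟩
  have h := (((hY t ht).sub (hY s hs)).sub_const (f s * (g t - g s))).abs
  refine le_of_tendsto h ?_
  filter_upwards [hmem s, hmem t] with R h1 h2
  have := hΦ R s (by simp [h1]) t (by simp [h2]) hst M hM
  simpa [Ψ] using this

lemma yrs_osc (a b : ℝ) (f g : ℝ → ℝ)
    (hno : ∀ t ∈ Set.Icc a b,
      ContinuousWithinAt f (Set.Icc a b) t ∨ ContinuousWithinAt g (Set.Icc a b) t)
    (η : ℝ) (hη : 0 < η) :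
    ∃ δ > 0, ∀ s t, a ≤ s → s ≤ t → t ≤ b → t - s < δ →
      (∀ u ∈ Set.Icc s t, ∀ v ∈ Set.Icc s t, |f v - f u| ≤ η) ∨
      (∀ u ∈ Set.Icc s t, ∀ v ∈ Set.Icc s t, |g v - g u| ≤ η) := by
  have aux : ∀ (h : ℝ → ℝ) (t : ℝ), ContinuousWithinAt h (Set.Icc a b) t →
      ∃ r > 0, ∀ u ∈ Set.Icc a b, u ∈ Metric.ball t r →
        ∀ v ∈ Set.Icc a b, v ∈ Metric.ball t r → |h v - h u| ≤ η := by
    intro h t ht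
    obtain ⟨r, hr, H⟩ := Metric.continuousWithinAt_iff.1 ht (η / 2) (by positivity)
    refine ⟨r, hr, fun u hu hu' v hv hv' => ?_⟩
    have h1 := H hu hu'
    have h2 := H hv hv'
    rw [Real.dist_eq, abs_lt] at h1 h2
    rw [abs_le]
    constructor <;> linarith [h1.1, h1.2, h2.1, h2.2]
  have aux2 : ∀ t ∈ Set.Icc a b, ∃ r > 0,
      (∀ u ∈ Set.Icc a b, u ∈ Metric.ball t r →
        ∀ v ∈ Set.Icc a b, v ∈ Metric.ball t r → |f v - f u| ≤ η) ∨
      (∀ u ∈ Set.Icc a b, u ∈ Metric.ball t r →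
        ∀ v ∈ Set.Icc a b, v ∈ Metric.ball t r → |g v - g u| ≤ η) := by
    intro t ht
    rcases hno t ht with h | h
    · obtain ⟨r, hr, H⟩ := aux f t h
      exact ⟨r, hr, Or.inl H⟩
    · obtain ⟨r, hr, H⟩ := aux g t h
      exact ⟨r, hr, Or.inr H⟩
  choose! r hr H using aux2
  obtain ⟨δ, hδ, hL⟩ := lebesgue_number_lemma_of_metric (isCompact_Icc (a := a) (b := b))
    (c := fun t : Set.Icc a b => Metric.ball (t : ℝ) (r t)) (fun _ => Metric.isOpen_ball)
    (fun t ht => Set.mem_iUnion.2 ⟨⟨t, ht⟩, Metric.mem_ball_self (hr t ht)⟩)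
  refine ⟨δ, hδ, fun s t hs hst ht hd => ?_⟩
  obtain ⟨c, hc⟩ := hL s ⟨hs, hst.trans ht⟩
  have hsub : ∀ u ∈ Set.Icc s t, u ∈ Metric.ball (c : ℝ) (r c) := by
    intro u hu
    apply hc
    rw [Metric.mem_ball, Real.dist_eq, abs_lt]
    constructor <;> linarith [hu.1, hu.2]
  have hI : ∀ u ∈ Set.Icc s t, u ∈ Set.Icc a b := fun u hu => ⟨hs.trans hu.1, hu.2.trans ht⟩
  rcases H c c.2 with h | h
  · exact Or.inl fun u hu v hv => h u (hI u hu) (hsub u hu) v (hI v hv) (hsub v hv)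
  · exact Or.inr fun u hu v hv => h u (hI u hu) (hsub u hu) v (hI v hv) (hsub v hv)

/-- Young's existence theorem for the Riemann–Stieltjes integral:
if `f` has finite `p`-variation, `g` has finite `q`-variation, `1/p + 1/q > 1`,
and `f`, `g` have no common discontinuity in `[a,b]`, then `∫_a^b f dg` exists
as a limit of Riemann–Stieltjes sums. -/
theorem young_riemann_stieltjes_existence
    (a b : ℝ) (hab : a < b) (p q : ℝ) (hp : 0 < p) (hq : 0 < q)
    (hpq : 1 / p + 1 / q > 1)
    (f g : ℝ → ℝ) (Vf Vg : ℝ) (hVf : 0 ≤ Vf) (hVg : 0 ≤ Vg)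
    (hfvar : ∀ (n : ℕ) (x : ℕ → ℝ), x 0 = a → x n = b →
      (∀ i < n, x i ≤ x (i + 1)) →
      ∑ i ∈ Finset.range n, |f (x (i + 1)) - f (x i)| ^ p ≤ Vf ^ p)
    (hgvar : ∀ (n : ℕ) (x : ℕ → ℝ), x 0 = a → x n = b →
      (∀ i < n, x i ≤ x (i + 1)) →
      ∑ i ∈ Finset.range n, |g (x (i + 1)) - g (x i)| ^ q ≤ Vg ^ q)
    (hnocommon : ∀ t ∈ Set.Icc a b,
      ContinuousWithinAt f (Set.Icc a b) t ∨ ContinuousWithinAt g (Set.Icc a b) t) :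
    ∃ I : ℝ, ∀ ε > 0, ∃ δ > 0, ∀ (n : ℕ) (x ξ : ℕ → ℝ),
      x 0 = a → x n = b → (∀ i < n, x i ≤ x (i + 1)) →
      (∀ i < n, x (i + 1) - x i < δ) →
      (∀ i < n, ξ i ∈ Set.Icc (x i) (x (i + 1))) →
      |∑ i ∈ Finset.range n, f (ξ i) * (g (x (i + 1)) - g (x i)) - I| < ε := by
  obtain ⟨Wf, hWf⟩ := yrs_var a b p f _ hfvar
  obtain ⟨Wg, hWg⟩ := yrs_var a b q g _ hgvar
  set θ : ℝ := 1 / p + 1 / q with hθ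
  have hθ1 : 1 < θ := hpq
  set H : ℝ → ℝ := fun t => Wf t + Wg t with hH
  have hf0 : ∀ s t, a ≤ s → s ≤ t → t ≤ b → 0 ≤ Wf t - Wf s := fun s t h1 h2 h3 =>
    (by positivity : 0 ≤ |f t - f s| ^ p).trans (hWf s t h1 h2 h3)
  have hg0 : ∀ s t, a ≤ s → s ≤ t → t ≤ b → 0 ≤ Wg t - Wg s := fun s t h1 h2 h3 =>
    (by positivity : 0 ≤ |g t - g s| ^ q).trans (hWg s t h1 h2 h3)
  have hHm : ∀ s t, a ≤ s → s ≤ t → t ≤ b → H s ≤ H t := by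
    intro s t h1 h2 h3
    have := hf0 s t h1 h2 h3
    have := hg0 s t h1 h2 h3
    simp only [hH]; linarith
  have hfH : ∀ s t, a ≤ s → s ≤ t → t ≤ b → |f t - f s| ≤ (H t - H s) ^ (1 / p) := by
    intro s t h1 h2 h3
    rw [one_div, Real.le_rpow_inv_iff_of_pos (abs_nonneg _)
      (sub_nonneg.2 (hHm s t h1 h2 h3)) hp]
    have := hWf s t h1 h2 h3
    have := hg0 s t h1 h2 h3
    simp only [hH]; linarith
  have hgH : ∀ s t, a ≤ s → s ≤ t → t ≤ b → |g t - g s| ≤ (H t - H s) ^ (1 / q) := by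
    intro s t h1 h2 h3
    rw [one_div, Real.le_rpow_inv_iff_of_pos (abs_nonneg _)
      (sub_nonneg.2 (hHm s t h1 h2 h3)) hq]
    have := hWg s t h1 h2 h3
    have := hf0 s t h1 h2 h3
    simp only [hH]; linarith
  set D := H b - H a with hD
  have hD0 : 0 ≤ D := sub_nonneg.2 (hHm a b le_rfl hab.le le_rfl)
  set N : ℝ := D ^ (1 / p) + D ^ (1 / q) with hN
  have hN0 : 0 ≤ N := by positivity
  have hDle : ∀ s t, a ≤ s → s ≤ t → t ≤ b → H t - H s ≤ D := by
    intro s t h1 h2 h3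
    have := hHm a s le_rfl h1 (h2.trans h3)
    have := hHm t b (h1.trans h2) h3 le_rfl
    linarith
  have hfN : ∀ s t, a ≤ s → s ≤ t → t ≤ b → |f t - f s| ≤ N := by
    intro s t h1 h2 h3
    refine (hfH s t h1 h2 h3).trans ?_
    have : (H t - H s) ^ (1 / p) ≤ D ^ (1 / p) :=
      Real.rpow_le_rpow (sub_nonneg.2 (hHm s t h1 h2 h3)) (hDle s t h1 h2 h3) (by positivity)
    have : 0 ≤ D ^ (1 / q) := by positivity
    linarith
  have hgN : ∀ s t, a ≤ s → s ≤ t → t ≤ b → |g t - g s| ≤ N := by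
    intro s t h1 h2 h3
    refine (hgH s t h1 h2 h3).trans ?_
    have : (H t - H s) ^ (1 / q) ≤ D ^ (1 / q) :=
      Real.rpow_le_rpow (sub_nonneg.2 (hHm s t h1 h2 h3)) (hDle s t h1 h2 h3) (by positivity)
    have : 0 ≤ D ^ (1 / p) := by positivity
    linarith
  -- exponents
  set α : ℝ := (θ - 1) / (2 * θ) with hα
  have hα0 : 0 < α := by
    have : 0 < θ - 1 := by linarith
    positivity
  set τ : ℝ := (θ + 1) / 2 with hτ
  have hτ1 : 1 < τ := by rw [hτ]; linarith
  have hτα : τ = θ * (1 - α) := by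
    rw [hτ, hα]; have : θ ≠ 0 := by linarith
    field_simp; ring
  have hα1 : 0 ≤ 1 - α := by
    by_contra hcon
    push Not at hcon
    nlinarith
  -- product estimate
  have hprod : ∀ η ≥ 0, ∀ s t, a ≤ s → s ≤ t → t ≤ b →
      ((∀ u ∈ Set.Icc s t, ∀ v ∈ Set.Icc s t, |f v - f u| ≤ η) ∨
      (∀ u ∈ Set.Icc s t, ∀ v ∈ Set.Icc s t, |g v - g u| ≤ η)) →
      ∀ u v v' w, s ≤ u → u ≤ v → v ≤ w → u ≤ v' → v' ≤ w → w ≤ t →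
        |f v - f u| * |g w - g v'| ≤ (η * N) ^ α * (H w - H u) ^ τ := by
    intro η hη s t hs hst ht hor u v v' w h1 h2 h3 h2' h3' h4
    have hbw : w ≤ b := h4.trans ht
    have hau : a ≤ u := hs.trans h1
    have k1 : |f v - f u| * |g w - g v'| ≤ η * N := by
      rcases hor with h | h
      · exact mul_le_mul (h u ⟨h1, by linarith⟩ v ⟨by linarith, by linarith⟩)
          (hgN v' w (by linarith) h3' hbw) (abs_nonneg _) hη
      · rw [mul_comm]
        exact mul_le_mul (h v' ⟨by linarith, by linarith⟩ w ⟨by linarith, by linarith⟩)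
          (hfN u v hau h2 (by linarith)) (abs_nonneg _) hη
    have hX : 0 ≤ H w - H u := sub_nonneg.2 (hHm u w hau (h2.trans h3) hbw)
    have k2 : |f v - f u| * |g w - g v'| ≤ (H w - H u) ^ θ := by
      have i1 : |f v - f u| ≤ (H w - H u) ^ (1 / p) := by
        refine (hfH u v hau h2 (by linarith)).trans ?_
        have := hHm v w (by linarith) h3 hbw
        have := hHm u v hau h2 (by linarith)
        exact Real.rpow_le_rpow (by linarith) (by linarith) (by positivity)
      have i2 : |g w - g v'| ≤ (H w - H u) ^ (1 / q) := by
        refine (hgH v' w (by linarith) h3' hbw).trans ?_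
        have := hHm v' w (by linarith) h3' hbw
        have := hHm u v' hau h2' (by linarith)
        exact Real.rpow_le_rpow (by linarith) (by linarith) (by positivity)
      calc _ ≤ (H w - H u) ^ (1 / p) * (H w - H u) ^ (1 / q) :=
            mul_le_mul i1 i2 (abs_nonneg _) (by positivity)
        _ = _ := by
            rw [hθ, Real.rpow_add' hX]
            linarith
    set Z := |f v - f u| * |g w - g v'| with hZ
    have hZ0 : 0 ≤ Z := by positivity
    calc Z = Z ^ α * Z ^ (1 - α) := by
          rw [← Real.rpow_add' hZ0 (by simp)]; simp
      _ ≤ (η * N) ^ α * ((H w - H u) ^ θ) ^ (1 - α) := by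
          gcongr
      _ = _ := by rw [← Real.rpow_mul hX, ← hτα]
  obtain ⟨C, hC0, hC⟩ := yrs_sew τ hτ1
  have hbd : ∀ η ≥ 0, ∀ s t, a ≤ s → s ≤ t → t ≤ b →
      ((∀ u ∈ Set.Icc s t, ∀ v ∈ Set.Icc s t, |f v - f u| ≤ η) ∨
      (∀ u ∈ Set.Icc s t, ∀ v ∈ Set.Icc s t, |g v - g u| ≤ η)) →
      YrsBd f g s t (C * (η * N) ^ α * (H t - H s) ^ τ) := by
    intro η hη s t hs hst ht hor x i j hx hij hi hj
    have := hC (fun k => f (x k)) (fun k => g (x k)) (fun k => H (x k)) ((η * N) ^ α) i j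
      (by positivity)
      (fun u v h1 h2 h3 => hHm _ _ (by have := hx h1; linarith) (hx h2)
        (by have := hx h3; linarith))
      (fun u v w h1 h2 h3 h4 => hprod η hη s t hs hst ht hor _ _ _ _
        (by have := hx h1; linarith) (hx h2) (hx h3) (hx h2) (hx h3)
        (by have := hx h4; linarith))
      (j - i) i j le_rfl le_rfl hij le_rfl
    simpa only [hi, hj] using this
  obtain ⟨Φ, hΦ⟩ := yrs_limit a b f g (fun t ht => ⟨_, hbd N hN0 a t le_rfl ht.1 ht.2 (Or.inl (by
    intro u hu v hv
    rcases le_total u v with h | h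
    · exact hfN u v hu.1 h (hv.2.trans ht.2)
    · rw [abs_sub_comm]
      exact hfN v u hv.1 h (hu.2.trans ht.2)))⟩)
  refine ⟨Φ b - Φ a, fun ε hε => ?_⟩
  set L : ℝ := (C + 1) * D ^ τ with hL
  have hL0 : 0 ≤ L := by positivity
  set K : ℝ := ε / (L + 1) with hK
  have hK0 : 0 < K := by positivity
  set η : ℝ := K ^ (1 / α) / (N + 1) with hη
  have hη0 : 0 < η := by positivity
  have hηK : (η * N) ^ α ≤ K := by
    have h1 : η * N ≤ K ^ (1 / α) := by
      rw [hη, div_mul_eq_mul_div, div_le_iff₀ (by positivity)]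
      have : 0 < K ^ (1 / α) := by positivity
      nlinarith
    calc (η * N) ^ α ≤ (K ^ (1 / α)) ^ α := by gcongr
      _ = K := by rw [← Real.rpow_mul hK0.le, one_div, inv_mul_cancel₀ hα0.ne', Real.rpow_one]
  obtain ⟨δ, hδ, hosc⟩ := yrs_osc a b f g hnocommon η hη0
  refine ⟨δ, hδ, fun n x ξ hx0 hxn hx hmesh hξ => ?_⟩
  have hmono := yrs_step_mono hx
  have hax : ∀ i, i ≤ n → a ≤ x i := fun i hi => hx0 ▸ hmono 0 i (Nat.zero_le _) hi
  have hxb : ∀ i, i ≤ n → x i ≤ b := fun i hi => hxn ▸ hmono i n hi le_rfl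
  have htel : Φ b - Φ a = ∑ i ∈ Finset.range n, (Φ (x (i + 1)) - Φ (x i)) := by
    rw [Finset.sum_range_sub (fun i => Φ (x i)), hx0, hxn]
  have htelH : D = ∑ i ∈ Finset.range n, (H (x (i + 1)) - H (x i)) := by
    rw [Finset.sum_range_sub (fun i => H (x i)), hx0, hxn]
  have hterm : ∀ i ∈ Finset.range n,
      |f (ξ i) * (g (x (i + 1)) - g (x i)) - (Φ (x (i + 1)) - Φ (x i))| ≤
        (C + 1) * K * D ^ (τ - 1) * (H (x (i + 1)) - H (x i)) := by
    intro i hi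
    have hi := Finset.mem_range.1 hi
    have hs := hax i hi.le
    have hst := hx i hi
    have ht := hxb (i + 1) hi
    set s := x i with hsdef
    set t := x (i + 1) with htdef
    have hor := hosc s t hs hst ht (hmesh i hi)
    have h1 := hΦ s ⟨hs, by linarith⟩ t ⟨by linarith, ht⟩ hst _ (hbd η hη0.le s t hs hst ht hor)
    have h2 := hprod η hη0.le s t hs hst ht hor s (ξ i) s t le_rfl (hξ i hi).1 (hξ i hi).2
      le_rfl hst le_rfl
    rw [← abs_mul] at h2
    have hX0 : 0 ≤ H t - H s := sub_nonneg.2 (hHm s t hs hst ht)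
    have hXτ : (H t - H s) ^ τ ≤ D ^ (τ - 1) * (H t - H s) := by
      calc (H t - H s) ^ τ = (H t - H s) ^ (τ - 1) * (H t - H s) := by
            conv_rhs => rw [← Real.rpow_one (H t - H s), ← Real.rpow_mul hX0, one_mul,
              ← Real.rpow_add' hX0 (by linarith)]
            ring_nf
        _ ≤ _ := by
            have : (H t - H s) ^ (τ - 1) ≤ D ^ (τ - 1) :=
              Real.rpow_le_rpow hX0 (hDle s t hs hst ht) (by linarith)
            gcongr
    have h3 : (C + 1) * (η * N) ^ α * (H t - H s) ^ τ ≤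
        (C + 1) * K * (D ^ (τ - 1) * (H t - H s)) := by
      gcongr
    have h4 : f (ξ i) * (g t - g s) - (Φ t - Φ s) =
        (f (ξ i) - f s) * (g t - g s) - (Φ t - Φ s - f s * (g t - g s)) := by ring
    rw [h4]
    refine (abs_sub _ _).trans ?_
    linarith
  rw [htel, ← Finset.sum_sub_distrib]
  refine (Finset.abs_sum_le_sum_abs _ _).trans_lt ((Finset.sum_le_sum hterm).trans_lt ?_)
  rw [← Finset.mul_sum, ← htelH]
  have hDτ : D ^ (τ - 1) * D = D ^ τ := by
    conv_lhs => rw [← Real.rpow_one D, ← Real.rpow_mul hD0, one_mul,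
      ← Real.rpow_add' hD0 (by linarith)]
    ring_nf
  calc (C + 1) * K * D ^ (τ - 1) * D = K * ((C + 1) * (D ^ (τ - 1) * D)) := by ring
    _ = K * L := by rw [hDτ]
    _ < K * (L + 1) := by nlinarith
    _ = ε := by rw [hK]; field_simp
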